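/- Suppose f : ℝ → ℝ solves the safe-integration equation for (g₀, h₀, h₁). Then for every n ∈ ℕ and every x ∈ [2n, 2n+1], f(x) = f(2n) + (f(2n+1) − f(2n))·(p(x+1) − n). -/

import Mathlib

noncomputable def parity (x : ℝ) : ℝ := max 0 (Real.pi / 2 * Real.sin (Real.pi * x))

noncomputable def pfun (x : ℝ) : ℝ := ∫ t in (0:ℝ)..(x - 1), parity t

noncomputable def pfun' (x : ℝ) : ℝ := pfun (x - 1) + 1

def SolvesSafeIntegration (g0 : ℝ) (h0 h1 : ℝ → ℝ → ℝ) (f : ℝ → ℝ) : Prop :=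
  f 0 = g0 ∧ ∀ x : ℝ, HasDerivAt f
    (parity x * (h1 (pfun x) (f (pfun x)) - f (2 * pfun x)) +
     parity (x - 1) * (h0 (pfun' x) (f (pfun' x)) - f (2 * pfun' x - 1))) x

theorem continuous_parity : Continuous parity := by
  unfold parity
  fun_prop

theorem parity_periodic : Function.Periodic parity 2 := by
  intro x
  have h : Real.pi * (x + 2) = Real.pi * x + 2 * Real.pi := by ring
  simp only [parity, h, Real.sin_add_two_pi]

theorem parity_eq_sin {x : ℝ} (hx : x ∈ Set.Icc (0 : ℝ) 1) :
    parity x = Real.pi / 2 * Real.sin (Real.pi * x) := by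
  have hpi := Real.pi_pos
  have hs : 0 ≤ Real.sin (Real.pi * x) :=
    Real.sin_nonneg_of_nonneg_of_le_pi (by nlinarith [hx.1]) (by nlinarith [hx.2])
  exact max_eq_right (by positivity)

theorem parity_eq_zero (n : ℕ) {x : ℝ} (hx : x ∈ Set.Icc (2 * n - 1 : ℝ) (2 * n)) :
    parity x = 0 := by
  have hpi := Real.pi_pos
  have hs : Real.sin (Real.pi * x - n * (2 * Real.pi)) ≤ 0 :=
    Real.sin_nonpos_of_nonpos_of_neg_pi_le (by nlinarith [hx.2]) (by nlinarith [hx.1])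
  rw [Real.sin_sub_nat_mul_two_pi] at hs
  exact max_eq_left (mul_nonpos_of_nonneg_of_nonpos (by positivity) hs)

theorem integral_parity_zero_one : ∫ t in (0 : ℝ)..1, parity t = 1 := by
  have hsin : ∫ t in (0 : ℝ)..1, parity t =
      ∫ t in (0 : ℝ)..1, Real.pi / 2 * Real.sin (Real.pi * t) := by
    refine intervalIntegral.integral_congr fun t ht => parity_eq_sin ?_
    rwa [Set.uIcc_of_le zero_le_one] at ht
  rw [hsin, intervalIntegral.integral_const_mul,
    intervalIntegral.integral_comp_mul_left _ Real.pi_ne_zero]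
  simp only [mul_zero, mul_one, integral_sin, Real.cos_zero, Real.cos_pi, smul_eq_mul]
  field_simp [Real.pi_ne_zero]
  norm_num

theorem integral_parity_eq_zero (n : ℕ) {y : ℝ} (hy : y ∈ Set.Icc (2 * n - 1 : ℝ) (2 * n)) :
    ∫ t in y..(2 * n : ℝ), parity t = 0 := by
  rw [← intervalIntegral.integral_zero (a := y) (b := 2 * n)]
  refine intervalIntegral.integral_congr fun t ht => parity_eq_zero n ?_
  rw [Set.uIcc_of_le hy.2] at ht
  exact ⟨hy.1.trans ht.1, ht.2⟩

theorem integral_parity_zero_two_mul (n : ℕ) : ∫ t in (0 : ℝ)..(2 * n), parity t = n := by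
  have hint (a b : ℝ) := continuous_parity.intervalIntegrable (μ := MeasureTheory.volume) a b
  have hzero : ∫ t in (1 : ℝ)..2, parity t = 0 := by
    simpa using integral_parity_eq_zero 1 (y := 1) (by norm_num)
  have htwo : ∫ t in (0 : ℝ)..2, parity t = 1 := by
    rw [← intervalIntegral.integral_add_adjacent_intervals (hint 0 1) (hint 1 2),
      integral_parity_zero_one, hzero, add_zero]
  have h := parity_periodic.intervalIntegral_add_zsmul_eq n 0 hint
  simpa [htwo, mul_comm] using h

/-- `pfun` is constant on the intervals between an even integer and its successor. -/
theorem pfun_eq_natCast (n : ℕ) {x : ℝ} (hx : x ∈ Set.Icc (2 * n : ℝ) (2 * n + 1)) :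
    pfun x = n := by
  have hint (a b : ℝ) := continuous_parity.intervalIntegrable (μ := MeasureTheory.volume) a b
  have hadd := intervalIntegral.integral_add_adjacent_intervals
    (hint 0 (x - 1)) (hint (x - 1) (2 * n))
  rw [integral_parity_eq_zero n ⟨by linarith [hx.1], by linarith [hx.2]⟩,
    integral_parity_zero_two_mul, add_zero] at hadd
  exact hadd

theorem hasDerivAt_pfun_add_one (x : ℝ) : HasDerivAt (fun y => pfun (y + 1)) (parity x) x := by
  simpa only [pfun, add_sub_cancel_right] using
    continuous_parity.integral_hasStrictDerivAt 0 x |>.hasDerivAt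

theorem safe_integration_even_interval (g0 : ℝ) (h0 h1 : ℝ → ℝ → ℝ) (f : ℝ → ℝ)
    (hf : SolvesSafeIntegration g0 h0 h1 f) :
    ∀ n : ℕ, ∀ x ∈ Set.Icc ((2*n : ℝ)) (2*n + 1),
      f x = f (2*n) + (f (2*n + 1) - f (2*n)) * (pfun (x + 1) - n) := by
  intro n
  obtain ⟨c, hc⟩ : ∃ c, c = h1 n (f n) - f (2 * n) := ⟨_, rfl⟩
  have hderiv : ∀ y ∈ Set.Icc (2 * n : ℝ) (2 * n + 1), HasDerivAt f (parity y * c) y := by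
    intro y hy
    have h := hf.2 y
    rwa [parity_eq_zero n (x := y - 1) ⟨by linarith [hy.1], by linarith [hy.2]⟩, zero_mul,
      add_zero, pfun_eq_natCast n hy, ← hc] at h
  have hleft : pfun (2 * n + 1) = n := pfun_eq_natCast n ⟨by linarith, le_rfl⟩
  have hright : pfun (2 * n + 1 + 1) = n + 1 := by
    have h := pfun_eq_natCast (n + 1) (x := 2 * n + 1 + 1)
      ⟨by push_cast; linarith, by push_cast; linarith⟩
    exact_mod_cast h
  have hsol : ∀ y ∈ Set.Icc (2 * n : ℝ) (2 * n + 1),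
      f y = f (2 * n) + c * (pfun (y + 1) - n) := by
    have hg (y : ℝ) : HasDerivAt (fun y => f (2 * n) + c * (pfun (y + 1) - n)) (parity y * c) y := by
      simpa only [mul_comm] using
        (((hasDerivAt_pfun_add_one y).sub_const (n : ℝ)).const_mul c).const_add (f (2 * n))
    refine eq_of_has_deriv_right_eq
      (fun y hy => (hderiv y (Set.Ico_subset_Icc_self hy)).hasDerivWithinAt)
      (fun y _ => (hg y).hasDerivWithinAt)
      (fun y hy => (hderiv y hy).continuousAt.continuousWithinAt)
      (fun y _ => (hg y).continuousAt.continuousWithinAt) ?_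
    simp [hleft]
  intro x hx
  have hend := hsol (2 * n + 1) ⟨by linarith, le_rfl⟩
  rw [hright] at hend
  rw [hsol x hx, hend]
  ring
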